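/- Let λ ∈ V be a dominant weight and let w ∈ W be the maximal-length element of its coset wW_λ, where W_λ := {σ ∈ W : σλ = λ}. Fix an index 1 ≤ i ≤ r and v ∈ W^{P_i}, let u ∈ W^{P_i} be the minimal-length representative of (w⁻¹ * v) W_{P_i}, and let y ∈ W_{P_i} be the unique element with w⁻¹ * v = u y⁻¹ and ℓ(u y⁻¹) = ℓ(u) + ℓ(y). Let F := {μ ∈ P_λ^w : ⟨μ, v x_i⟩ = ⟨λ, u x_i⟩} be the corresponding face of P_λ^w. Then v⁻¹ · F = conv{y' u⁻¹ λ : y' ∈ W, y' ≤ y}; that is, the linear map μ ↦ v⁻¹ μ carries the face F isomorphically onto the Demazure polytope, for the Levi root subsystem Φ_{P_i}, associated to the (Φ_{P_i}-dominant) weight u⁻¹λ and the element y ∈ W_{P_i}. -/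

import Mathlib

open scoped Classical

/-- Data of a root system with a fixed choice of simple roots: an ambient
`ℚ`-vector space `V`, a set of roots `Φ` with a distinguished subset `pos` of
positive roots, a coroot functional `coroot β = ⟨·, β^∨⟩` for each root, and
simple roots `α 1, …, α r`. -/
structure RootData where
  r : ℕ
  V : Type
  [grp : AddCommGroup V]
  [mod : Module ℚ V]
  Φ : Set V
  pos : Set V
  coroot : V → Module.Dual ℚ V
  α : Fin r → V

attribute [instance] RootData.grp RootData.mod

namespace RootData

variable (R : RootData)

/-- The group of linear automorphisms of `V`, in which the Weyl group lives. -/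
abbrev Aut : Type := R.V ≃ₗ[ℚ] R.V

/-- The linear map `v ↦ v - ⟨v, β^∨⟩ β`. -/
noncomputable def reflMap (β : R.V) : R.V →ₗ[ℚ] R.V :=
  LinearMap.id - (R.coroot β).smulRight β

/-- The reflection `s_β` associated to a root `β`, as a linear automorphism. -/
noncomputable def s (β : R.V) : R.Aut :=
  if h : (R.reflMap β).comp (R.reflMap β) = LinearMap.id then
    LinearEquiv.ofLinear (R.reflMap β) (R.reflMap β) h h
  else LinearEquiv.refl ℚ R.V

/-- The simple reflections `s_i := s_{α_i}`. -/
noncomputable def S (i : Fin R.r) : R.Aut := R.s (R.α i)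

/-- The Weyl group `W`, generated by the simple reflections. -/
noncomputable def weylGroup : Subgroup R.Aut := Subgroup.closure (Set.range R.S)

/-- The product `s_{i_1} ⋯ s_{i_k}` of a word in the simple reflections. -/
noncomputable def wordProd (l : List (Fin R.r)) : R.Aut := (l.map R.S).prod

/-- The length function on `W`: least length of a word in the simple
reflections expressing the given element. -/
noncomputable def len (w : R.Aut) : ℕ :=
  sInf {n | ∃ l : List (Fin R.r), l.length = n ∧ R.wordProd l = w}

/-- A word is reduced if its length equals the length of its product. -/
def Reduced (l : List (Fin R.r)) : Prop := R.len (R.wordProd l) = l.length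

/-- The Bruhat order on `W`: `u ≤ w` iff some reduced word for `w` has a
subword whose product is `u`. -/
def BruhatLE (u w : R.Aut) : Prop :=
  ∃ l : List (Fin R.r), R.Reduced l ∧ R.wordProd l = w ∧
    ∃ l' : List (Fin R.r), l'.Sublist l ∧ R.wordProd l' = u

/-- Strict Bruhat order. -/
def BruhatLT (u w : R.Aut) : Prop := R.BruhatLE u w ∧ u ≠ w

/-- One step of the Demazure product: `s_i * w := max {w, s_i w}`. -/
noncomputable def dmulStep (i : Fin R.r) (x : R.Aut) : R.Aut :=
  if R.len x < R.len (R.S i * x) then R.S i * x else x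

/-- Demazure product of a word in the simple reflections against `w`:
`s_{i_1} * (s_{i_2} * (⋯ * (s_{i_k} * w)))`. -/
noncomputable def dmulList (l : List (Fin R.r)) (w : R.Aut) : R.Aut :=
  l.foldr R.dmulStep w

/-- The Demazure product `v * w` on the Weyl group, computed by choosing a
reduced word for `v` (it is independent of this choice). -/
noncomputable def dmul (v w : R.Aut) : R.Aut :=
  if h : ∃ l : List (Fin R.r), R.Reduced l ∧ R.wordProd l = v then
    R.dmulList h.choose w
  else v * w

/-- The parabolic subgroup `W_{P_i}` generated by the simple reflections
`s_j`, `j ≠ i`. -/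
noncomputable def WPar (i : Fin R.r) : Subgroup R.Aut :=
  Subgroup.closure (R.S '' {j | j ≠ i})

/-- `W^{P_i}`: the set of minimal-length representatives of cosets of
`W/W_{P_i}`. -/
def minReps (i : Fin R.r) : Set R.Aut :=
  {v | v ∈ R.weylGroup ∧ ∀ p ∈ R.WPar i, R.len v ≤ R.len (v * p)}

/-- `u` is the minimal-length representative of the coset `w W_{P_i}`. -/
def IsMinRep (i : Fin R.r) (u w : R.Aut) : Prop :=
  u ∈ R.minReps i ∧ u⁻¹ * w ∈ R.WPar i

/-- A weight is dominant if it pairs nonnegatively with every simple coroot. -/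
def Dominant (lam : R.V) : Prop := ∀ i : Fin R.r, 0 ≤ R.coroot (R.α i) lam

/-- The dual action of the Weyl group on `V* `: `(u f)(v) = f(u⁻¹ v)`. -/
noncomputable def dualAct (u : R.Aut) (f : Module.Dual ℚ R.V) : Module.Dual ℚ R.V :=
  f.comp (u.symm : R.V →ₗ[ℚ] R.V)

/-- The Demazure polytope `P_λ^w := conv {uλ : u ∈ W, u ≤ w}`. -/
noncomputable def demPolytope (lam : R.V) (w : R.Aut) : Set R.V :=
  convexHull ℚ {m | ∃ u : R.Aut, u ∈ R.weylGroup ∧ R.BruhatLE u w ∧ m = u lam}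

/-- Membership in the weight lattice `X`. -/
def IsWeight (lam : R.V) : Prop := ∀ β ∈ R.Φ, ∃ m : ℤ, R.coroot β lam = (m : ℚ)

/-- The root lattice `Q = ℤΦ`. -/
noncomputable def rootLattice : AddSubgroup R.V := AddSubgroup.closure R.Φ

/-- `w₀` is the longest element of the Weyl group. -/
def IsLongest (w₀ : R.Aut) : Prop :=
  w₀ ∈ R.weylGroup ∧ ∀ g ∈ R.weylGroup, R.len g ≤ R.len w₀

/-- The positive roots `Φ_{P_i}⁺ = Φ⁺ ∩ span {α_j : j ≠ i}` of the standard
Levi subsystem. -/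
def parPos (i : Fin R.r) : Set R.V :=
  {η | η ∈ R.pos ∧ η ∈ Submodule.span ℚ (R.α '' {j | j ≠ i})}

/-- The value `D_i (e^λ)` of the Demazure operator on a basis element of the
group ring `ℤ[X]`. -/
noncomputable def demOnBasis (i : Fin R.r) (lam : R.V) : R.V →₀ ℤ :=
  if 0 ≤ ⌊R.coroot (R.α i) lam⌋ then
    ∑ k ∈ Finset.range (⌊R.coroot (R.α i) lam⌋.toNat + 1),
      Finsupp.single (lam - (k : ℚ) • R.α i) 1
  else if ⌊R.coroot (R.α i) lam⌋ = -1 then 0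
  else - ∑ k ∈ Finset.range ((-⌊R.coroot (R.α i) lam⌋).toNat - 1),
      Finsupp.single (lam + ((k : ℚ) + 1) • R.α i) 1

/-- The Demazure operator `D_i`, as a `ℤ`-linear endomorphism of the group
ring `ℤ[X]` (realized as finitely supported functions `V →₀ ℤ`). -/
noncomputable def demOp (i : Fin R.r) : (R.V →₀ ℤ) →ₗ[ℤ] (R.V →₀ ℤ) :=
  Finsupp.lsum ℤ fun lam => LinearMap.toSpanSingleton ℤ (R.V →₀ ℤ) (R.demOnBasis i lam)

/-- The Demazure character `D_{i_1} ⋯ D_{i_k} (e^λ)`. -/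
noncomputable def demChar (l : List (Fin R.r)) (lam : R.V) : R.V →₀ ℤ :=
  l.foldr (fun i p => R.demOp i p) (Finsupp.single lam 1)

/-- The axioms of a finite crystallographic root system spanning `V`, with
simple roots `α_i` and positive roots `pos`. -/
structure IsRootSystem (R : RootData) : Prop where
  finite : R.Φ.Finite
  span_top : Submodule.span ℚ R.Φ = ⊤
  ne_zero : ∀ β ∈ R.Φ, β ≠ 0
  coroot_self : ∀ β ∈ R.Φ, R.coroot β β = 2
  crystallographic : ∀ β ∈ R.Φ, ∀ γ ∈ R.Φ, ∃ m : ℤ, R.coroot β γ = (m : ℚ)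
  reflection_stable : ∀ β ∈ R.Φ, ∀ γ ∈ R.Φ, γ - R.coroot β γ • β ∈ R.Φ
  simple_mem : ∀ i, R.α i ∈ R.Φ
  indep : LinearIndependent ℚ R.α
  pos_subset : R.pos ⊆ R.Φ
  pos_or_neg : ∀ β ∈ R.Φ, (β ∈ R.pos ∧ -β ∉ R.pos) ∨ (β ∉ R.pos ∧ -β ∈ R.pos)
  simple_pos : ∀ i, R.α i ∈ R.pos
  pos_nonneg_comb : ∀ β ∈ R.pos, ∃ c : Fin R.r → ℚ, (∀ i, 0 ≤ c i) ∧ β = ∑ i, c i • R.α i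

end RootData

namespace RootData

variable {R : RootData}

theorem Aut.inv_apply_self (g : R.Aut) (z : R.V) : g⁻¹ (g z) = z := g.symm_apply_apply z

theorem Aut.apply_inv_self (g : R.Aut) (z : R.V) : g (g⁻¹ z) = z := g.apply_symm_apply z

/-- The automorphisms of `V` that permute the roots. -/
def rootStab (R : RootData) : Subgroup R.Aut where
  carrier := {g | ∀ β, g β ∈ R.Φ ↔ β ∈ R.Φ}
  one_mem' := fun _ => Iff.rfl
  mul_mem' := fun {a b} ha hb β => (ha (b β)).trans (hb β)
  inv_mem' := fun {a} ha β => by rw [← ha (a⁻¹ β), Aut.apply_inv_self]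

/-- The strict step of the strong Bruhat order: left multiplication by a length-increasing
reflection. -/
def BruhatStep (R : RootData) (a b : R.Aut) : Prop :=
  ∃ β ∈ R.pos, a⁻¹ β ∈ R.pos ∧ b = R.s β * a

/-- The Bruhat order, presented by chains of length-increasing reflections. -/
def ChainLE (R : RootData) : R.Aut → R.Aut → Prop := Relation.ReflTransGen R.BruhatStep

theorem wordProd_cons (j : Fin R.r) (l : List (Fin R.r)) :
    R.wordProd (j :: l) = R.S j * R.wordProd l := by simp [wordProd]

theorem wordProd_nil : R.wordProd [] = 1 := rfl

theorem wordProd_append (l l' : List (Fin R.r)) :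
    R.wordProd (l ++ l') = R.wordProd l * R.wordProd l' := by simp [wordProd]

theorem len_wordProd_le (l : List (Fin R.r)) : R.len (R.wordProd l) ≤ l.length :=
  Nat.sInf_le ⟨l, rfl, rfl⟩

theorem exists_reduced_wordProd (l : List (Fin R.r)) :
    ∃ l', R.Reduced l' ∧ R.wordProd l' = R.wordProd l := by
  obtain ⟨l', h1, h2⟩ := Nat.sInf_mem
    (s := {n | ∃ l' : List (Fin R.r), l'.length = n ∧ R.wordProd l' = R.wordProd l})
    ⟨_, l, rfl, rfl⟩
  refine ⟨l', ?_, h2⟩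
  rw [Reduced, h2, h1, len]

theorem wordProd_mem (l : List (Fin R.r)) : R.wordProd l ∈ R.weylGroup :=
  Subgroup.list_prod_mem _ fun g hg => by
    obtain ⟨j, -, rfl⟩ := List.mem_map.1 hg
    exact Subgroup.subset_closure ⟨j, rfl⟩

theorem S_mem (j : Fin R.r) : R.S j ∈ R.weylGroup := Subgroup.subset_closure ⟨j, rfl⟩

theorem dmulStep_mem {g : R.Aut} (hg : g ∈ R.weylGroup) (j : Fin R.r) :
    R.dmulStep j g ∈ R.weylGroup := by
  unfold dmulStep
  split_ifs
  exacts [mul_mem (S_mem j) hg, hg]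

theorem dmulList_mem {g : R.Aut} (hg : g ∈ R.weylGroup) (l : List (Fin R.r)) :
    R.dmulList l g ∈ R.weylGroup := by
  induction l with
  | nil => exact hg
  | cons j l ih => exact dmulStep_mem ih j

theorem Reduced.tail {j : Fin R.r} {l : List (Fin R.r)} (h : R.Reduced (j :: l)) :
    R.Reduced l := by
  obtain ⟨l', h1, h2⟩ := exists_reduced_wordProd l
  refine le_antisymm (len_wordProd_le l) ?_
  have h3 := len_wordProd_le (j :: l')
  rw [wordProd_cons, h2, ← wordProd_cons, h, List.length_cons, List.length_cons, ← h1, h2] at h3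
  omega

theorem dmulList_one {l : List (Fin R.r)} (h : R.Reduced l) :
    R.dmulList l 1 = R.wordProd l := by
  induction l with
  | nil => rfl
  | cons j l ih =>
    have hl := Reduced.tail h
    change R.dmulStep j (R.dmulList l 1) = _
    rw [ih hl, dmulStep, if_pos, wordProd_cons]
    rw [← wordProd_cons, h, hl, List.length_cons]
    omega

theorem wordProd_mem_WPar {i : Fin R.r} {l : List (Fin R.r)} (h : ∀ j ∈ l, j ≠ i) :
    R.wordProd l ∈ R.WPar i :=
  Subgroup.list_prod_mem _ fun g hg => by
    obtain ⟨j, hj, rfl⟩ := List.mem_map.1 hg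
    exact Subgroup.subset_closure ⟨j, h j hj, rfl⟩

theorem WPar_le_weylGroup (i : Fin R.r) : R.WPar i ≤ R.weylGroup :=
  Subgroup.closure_mono (Set.image_subset_range _ _)

namespace IsRootSystem

theorem s_apply (hR : R.IsRootSystem) {β : R.V} (hβ : β ∈ R.Φ) (z : R.V) :
    R.s β z = z - R.coroot β z • β := by
  have h : (R.reflMap β).comp (R.reflMap β) = LinearMap.id := by
    ext z
    have h2 := hR.coroot_self β hβ
    simp only [reflMap, LinearMap.comp_apply, LinearMap.sub_apply, LinearMap.id_apply,
      LinearMap.smulRight_apply, map_sub, map_smul, h2]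
    module
  rw [s, dif_pos h]
  simp [reflMap]

theorem s_self (hR : R.IsRootSystem) {β : R.V} (hβ : β ∈ R.Φ) : R.s β β = -β := by
  rw [hR.s_apply hβ, hR.coroot_self β hβ]; module

theorem s_mul_s (hR : R.IsRootSystem) {β : R.V} (hβ : β ∈ R.Φ) : R.s β * R.s β = 1 := by
  ext z
  rw [LinearEquiv.mul_apply, hR.s_apply hβ, hR.s_apply hβ]
  simp only [map_sub, map_smul, hR.coroot_self β hβ, smul_eq_mul, LinearEquiv.coe_one, id]
  module

theorem s_inv (hR : R.IsRootSystem) {β : R.V} (hβ : β ∈ R.Φ) : (R.s β)⁻¹ = R.s β :=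
  inv_eq_of_mul_eq_one_left (hR.s_mul_s hβ)

theorem S_mul_S (hR : R.IsRootSystem) (j : Fin R.r) : R.S j * R.S j = 1 :=
  hR.s_mul_s (hR.simple_mem j)

theorem S_mul_S_mul (hR : R.IsRootSystem) (j : Fin R.r) (g : R.Aut) : R.S j * (R.S j * g) = g := by
  rw [← mul_assoc, hR.S_mul_S, one_mul]

theorem S_inv (hR : R.IsRootSystem) (j : Fin R.r) : (R.S j)⁻¹ = R.S j := hR.s_inv (hR.simple_mem j)

theorem s_mem_rootStab (hR : R.IsRootSystem) {β : R.V} (hβ : β ∈ R.Φ) : R.s β ∈ R.rootStab := by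
  have key : ∀ γ ∈ R.Φ, R.s β γ ∈ R.Φ := fun γ hγ => by
    rw [hR.s_apply hβ]; exact hR.reflection_stable β hβ γ hγ
  refine fun γ => ⟨fun h => ?_, key γ⟩
  have := key _ h
  rwa [← LinearEquiv.mul_apply, hR.s_mul_s hβ] at this

theorem S_mem_rootStab (hR : R.IsRootSystem) (j : Fin R.r) :
    R.S j ∈ R.rootStab := hR.s_mem_rootStab (hR.simple_mem j)

theorem weylGroup_le_rootStab (hR : R.IsRootSystem) : R.weylGroup ≤ R.rootStab := by
  rw [weylGroup, Subgroup.closure_le]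
  rintro _ ⟨j, rfl⟩
  exact hR.S_mem_rootStab j

theorem neg_mem (hR : R.IsRootSystem) {β : R.V} (hβ : β ∈ R.Φ) : -β ∈ R.Φ := by
  rw [← hR.s_self hβ]; exact (hR.s_mem_rootStab hβ β).2 hβ

theorem neg_notMem_pos (hR : R.IsRootSystem) {β : R.V} (hβ : β ∈ R.pos) : -β ∉ R.pos := by
  rcases hR.pos_or_neg β (hR.pos_subset hβ) with h | h
  · exact h.2
  · exact absurd hβ h.1

theorem neg_mem_pos (hR : R.IsRootSystem) {β : R.V} (hβ : β ∈ R.Φ) (h : β ∉ R.pos) :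
    -β ∈ R.pos := by
  rcases hR.pos_or_neg β hβ with h' | h'
  · exact absurd h'.1 h
  · exact h'.2

/-- A functional that takes the value `2` at a root and whose reflection preserves the roots is
the coroot. -/
theorem coroot_unique (hR : R.IsRootSystem) {β : R.V} (hβ : β ∈ R.Φ) (f : Module.Dual ℚ R.V)
    (hf : f β = 2)
    (h : ∀ γ ∈ R.Φ, γ - f γ • β ∈ R.Φ) : R.coroot β = f :=
  Module.Dual.eq_of_preReflection_mapsTo hR.finite hR.span_top (hR.coroot_self β hβ)
    (fun γ hγ => by simpa [Module.preReflection_apply] using hR.reflection_stable β hβ γ hγ) hf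
    (fun γ hγ => by simpa [Module.preReflection_apply] using h γ hγ)

theorem coroot_map (hR : R.IsRootSystem) {g : R.Aut} (hg : g ∈ R.rootStab) {β : R.V} (hβ : β ∈ R.Φ)
    (z : R.V) :
    R.coroot (g β) (g z) = R.coroot β z := by
  have := hR.coroot_unique ((hg β).2 hβ) ((R.coroot β).comp (g⁻¹ : R.Aut).toLinearMap)
    (by simp [hR.coroot_self β hβ]) (fun γ hγ => ?_)
  · simp [this]
  · have h1 := (hg _).2 (hR.reflection_stable β hβ (g⁻¹ γ) ((R.rootStab.inv_mem hg γ).2 hγ))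
    simpa [Aut.apply_inv_self] using h1

theorem s_map (hR : R.IsRootSystem) {g : R.Aut} (hg : g ∈ R.rootStab) {β : R.V} (hβ : β ∈ R.Φ) :
    R.s (g β) * g = g * R.s β := by
  ext z
  rw [LinearEquiv.mul_apply, LinearEquiv.mul_apply, hR.s_apply ((hg β).2 hβ), hR.s_apply hβ,
    hR.coroot_map hg hβ, map_sub, map_smul]

theorem s_smul (hR : R.IsRootSystem) {β : R.V} (hβ : β ∈ R.Φ) {c : ℚ} (hc : c ≠ 0)
    (hcβ : c • β ∈ R.Φ) :
    R.s (c • β) = R.s β := by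
  have := hR.coroot_unique hcβ (c⁻¹ • R.coroot β)
    (by simp [hR.coroot_self β hβ, hc]) (fun γ hγ => ?_)
  · ext z
    rw [hR.s_apply hcβ, hR.s_apply hβ, this]
    simp [smul_smul, mul_comm, hc]
  · have := hR.reflection_stable β hβ γ hγ
    convert this using 2
    simp [smul_smul, mul_comm, hc]


/-- The basis of `V` formed by the simple roots. -/
noncomputable def basis (hR : R.IsRootSystem) : Module.Basis (Fin R.r) ℚ R.V :=
  Module.Basis.mk hR.indep (by
    rw [← hR.span_top, Submodule.span_le]
    have key : ∀ β ∈ R.pos, β ∈ Submodule.span ℚ (Set.range R.α) := fun β hβ => by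
      obtain ⟨c, -, rfl⟩ := hR.pos_nonneg_comb β hβ
      exact Submodule.sum_mem _ fun j _ =>
        Submodule.smul_mem _ _ (Submodule.subset_span ⟨j, rfl⟩)
    intro β hβ
    by_cases h : β ∈ R.pos
    · exact key β h
    · simpa using Submodule.neg_mem _ (key _ (hR.neg_mem_pos hβ h)))

/-- The fundamental coweights. -/
noncomputable def coweight (hR : R.IsRootSystem) (j : Fin R.r) : Module.Dual ℚ R.V :=
  hR.basis.coord j

theorem basis_apply (hR : R.IsRootSystem) (j : Fin R.r) : hR.basis j = R.α j := by simp [basis]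

theorem coweight_simple (hR : R.IsRootSystem) (i j : Fin R.r) : hR.coweight j
    (R.α i) = if i = j then 1 else 0 := by
  rw [← hR.basis_apply i, coweight, Module.Basis.coord_apply, Module.Basis.repr_self,
    Finsupp.single_apply]

theorem sum_coweight (hR : R.IsRootSystem) (z : R.V) : ∑ j, hR.coweight j z • R.α j = z := by
  simpa [hR.basis_apply, coweight] using hR.basis.sum_repr z

theorem coweight_nonneg (hR : R.IsRootSystem) {β : R.V} (hβ : β ∈ R.pos) (j : Fin R.r) :
    0 ≤ hR.coweight j β := by
  obtain ⟨c, hc, rfl⟩ := hR.pos_nonneg_comb β hβ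
  simpa [hR.coweight_simple] using hc j

theorem coweight_nonpos (hR : R.IsRootSystem) {β : R.V} (hβ : β ∈ R.Φ) (h : β ∉ R.pos)
    (j : Fin R.r) :
    hR.coweight j β ≤ 0 := by
  simpa using hR.coweight_nonneg (hR.neg_mem_pos hβ h) j

theorem mem_pos_of_coweight_nonneg (hR : R.IsRootSystem) {β : R.V} (hβ : β ∈ R.Φ)
    (h : ∀ j, 0 ≤ hR.coweight j β) : β ∈ R.pos := by
  by_contra hn
  refine hR.ne_zero β hβ ?_
  rw [← hR.sum_coweight β]
  refine Finset.sum_eq_zero fun j _ => ?_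
  rw [le_antisymm (hR.coweight_nonpos hβ hn j) (h j), zero_smul]

theorem mem_pos_of_coweight_pos (hR : R.IsRootSystem) {β : R.V} (hβ : β ∈ R.Φ) {j : Fin R.r}
    (h : 0 < hR.coweight j β) : β ∈ R.pos := by
  by_contra hn
  exact absurd h (hR.coweight_nonpos hβ hn j).not_gt

theorem S_apply (hR : R.IsRootSystem) (j : Fin R.r) (z : R.V) : R.S j z = z - R.coroot
    (R.α j) z • R.α j :=
  hR.s_apply (hR.simple_mem j) z

theorem coweight_S (hR : R.IsRootSystem) {i j : Fin R.r} (h : j ≠ i) (z : R.V) :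
    hR.coweight i (R.S j z) = hR.coweight i z := by
  simp [hR.S_apply, hR.coweight_simple, h]

/-- A positive root made negative by a simple reflection is a multiple of that simple root. -/
theorem eq_smul_simple (hR : R.IsRootSystem) {β : R.V} (hβ : β ∈ R.pos) {j : Fin R.r}
    (h : R.S j β ∉ R.pos) :
    0 < hR.coweight j β ∧ β = hR.coweight j β • R.α j := by
  have hΦ := hR.pos_subset hβ
  have hz : ∀ k, k ≠ j → hR.coweight k β = 0 := fun k hk => by
    refine le_antisymm ?_ (hR.coweight_nonneg hβ k)
    rw [← hR.coweight_S hk.symm]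
    exact hR.coweight_nonpos ((hR.S_mem_rootStab j β).2 hΦ) h k
  have he : β = hR.coweight j β • R.α j := by
    conv_lhs => rw [← hR.sum_coweight β]
    refine Finset.sum_eq_single j (fun k _ hk => ?_) (by simp)
    rw [hz k hk, zero_smul]
  refine ⟨(hR.coweight_nonneg hβ j).lt_of_ne fun h0 => hR.ne_zero β hΦ ?_, he⟩
  rw [he, ← h0, zero_smul]

theorem s_eq_S (hR : R.IsRootSystem) {β : R.V} (hβ : β ∈ R.pos) {j : Fin R.r}
    (h : R.S j β ∉ R.pos) :
    R.s β = R.S j := by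
  obtain ⟨h0, h1⟩ := hR.eq_smul_simple hβ h
  have := hR.s_smul (hR.simple_mem j) h0.ne' (h1 ▸ hR.pos_subset hβ)
  rwa [← h1] at this

theorem s_mul_S (hR : R.IsRootSystem) (j : Fin R.r) {β : R.V} (hβ : β ∈ R.Φ) :
    R.s (R.S j β) * R.S j = R.S j * R.s β := hR.s_map (hR.S_mem_rootStab j) hβ

/-- The strong exchange property, for words that need not be reduced. -/
theorem exchange (hR : R.IsRootSystem) (l : List (Fin R.r)) {β : R.V} (hβ : β ∈ R.pos)
    (h : (R.wordProd l)⁻¹ β ∉ R.pos) :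
    ∃ l' : List (Fin R.r), l'.Sublist l ∧ l'.length < l.length ∧
      R.s β * R.wordProd l = R.wordProd l' := by
  induction l generalizing β with
  | nil => exact absurd hβ h
  | cons j l ih =>
    rw [wordProd_cons] at h ⊢
    by_cases hj : R.S j β ∈ R.pos
    · rw [mul_inv_rev, hR.S_inv, LinearEquiv.mul_apply] at h
      obtain ⟨l', h1, h2, h3⟩ := ih hj h
      refine ⟨j :: l', h1.cons_cons j, by simpa using h2, ?_⟩
      rw [wordProd_cons, ← h3, ← mul_assoc, ← mul_assoc]
      have := hR.s_mul_S j (hR.pos_subset hβ)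
      rw [← mul_left_inj (R.S j), mul_assoc, hR.S_mul_S, mul_one] at this
      congr 1
      rw [this, ← mul_assoc, ← mul_assoc, hR.S_mul_S, one_mul]
    · exact ⟨l, List.sublist_cons_self j l, by simp, by
        rw [hR.s_eq_S hβ hj, hR.S_mul_S_mul]⟩

theorem wordProd_reverse (hR : R.IsRootSystem) (l : List (Fin R.r)) : R.wordProd l.reverse =
    (R.wordProd l)⁻¹ := by
  induction l with
  | nil => simp [wordProd]
  | cons j l ih =>
    rw [List.reverse_cons, wordProd_append, ih, wordProd_cons, wordProd_cons, mul_inv_rev,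
      hR.S_inv, wordProd_nil, mul_one]

theorem exists_reduced (hR : R.IsRootSystem) {g : R.Aut} (hg : g ∈ R.weylGroup) :
    ∃ l, R.Reduced l ∧ R.wordProd l = g := by
  suffices ∃ l, R.wordProd l = g by
    obtain ⟨l, rfl⟩ := this
    exact exists_reduced_wordProd l
  induction hg using Subgroup.closure_induction with
  | mem g hg =>
    obtain ⟨j, rfl⟩ := hg
    exact ⟨[j], by simp [wordProd]⟩
  | one => exact ⟨[], rfl⟩
  | mul a b _ _ ha hb =>
    obtain ⟨la, rfl⟩ := ha
    obtain ⟨lb, rfl⟩ := hb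
    exact ⟨la ++ lb, wordProd_append la lb⟩
  | inv a _ ha =>
    obtain ⟨la, rfl⟩ := ha
    exact ⟨la.reverse, hR.wordProd_reverse la⟩

theorem len_inv (hR : R.IsRootSystem) {g : R.Aut} (hg : g ∈ R.weylGroup) : R.len g⁻¹ = R.len g := by
  have key : ∀ g ∈ R.weylGroup, R.len g⁻¹ ≤ R.len g := fun g hg => by
    obtain ⟨l, hl, rfl⟩ := hR.exists_reduced hg
    rw [hl, ← hR.wordProd_reverse, ← List.length_reverse]
    exact len_wordProd_le _
  refine le_antisymm (key g hg) ?_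
  simpa using key _ (inv_mem hg)

theorem reduced_reverse (hR : R.IsRootSystem) {l : List (Fin R.r)} (hl : R.Reduced l) :
    R.Reduced l.reverse := by
  rw [Reduced, hR.wordProd_reverse, hR.len_inv (wordProd_mem l), hl, List.length_reverse]

theorem exists_sublist_of_step (hR : R.IsRootSystem) {a : R.Aut} {l : List (Fin R.r)}
    (h : R.BruhatStep a (R.wordProd l)) :
    ∃ l' : List (Fin R.r), l'.Sublist l ∧ l'.length < l.length ∧ R.wordProd l' = a := by
  obtain ⟨β, hβ, hβ', hl⟩ := h
  have hΦ := hR.pos_subset hβ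
  have hn : (R.wordProd l)⁻¹ β ∉ R.pos := by
    rw [hl, mul_inv_rev, hR.s_inv hΦ, LinearEquiv.mul_apply, hR.s_self hΦ, map_neg]
    exact hR.neg_notMem_pos hβ'
  obtain ⟨l', h1, h2, h3⟩ := hR.exchange l hβ hn
  refine ⟨l', h1, h2, ?_⟩
  rw [← h3, hl, ← mul_assoc, hR.s_mul_s hΦ, one_mul]

theorem exists_sublist_of_chainLE (hR : R.IsRootSystem) {a b : R.Aut} (h : R.ChainLE a b)
    {l : List (Fin R.r)}
    (hl : R.wordProd l = b) : ∃ l' : List (Fin R.r), l'.Sublist l ∧ R.wordProd l' = a := by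
  induction h using Relation.ReflTransGen.head_induction_on with
  | refl => exact ⟨l, List.Sublist.refl l, hl⟩
  | head hs _ ih =>
    obtain ⟨l', h1, rfl⟩ := ih
    obtain ⟨l'', h2, -, h3⟩ := hR.exists_sublist_of_step hs
    exact ⟨l'', h2.trans h1, h3⟩

theorem len_lt_of_step (hR : R.IsRootSystem) {a b : R.Aut} (h : R.BruhatStep a b)
    (hb : b ∈ R.weylGroup) :
    R.len a < R.len b := by
  obtain ⟨l, hl, rfl⟩ := hR.exists_reduced hb
  obtain ⟨l', -, h2, rfl⟩ := hR.exists_sublist_of_step h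
  rw [hl]
  exact (len_wordProd_le l').trans_lt h2

theorem len_le_of_chainLE (hR : R.IsRootSystem) {a b : R.Aut} (h : R.ChainLE a b)
    (hb : b ∈ R.weylGroup) :
    R.len a ≤ R.len b := by
  obtain ⟨l, hl, rfl⟩ := hR.exists_reduced hb
  obtain ⟨l', h1, rfl⟩ := hR.exists_sublist_of_chainLE h rfl
  rw [hl]
  exact (len_wordProd_le l').trans h1.length_le

theorem len_lt_of_chainLE (hR : R.IsRootSystem) {a b : R.Aut} (h : R.ChainLE a b)
    (hb : b ∈ R.weylGroup)
    (hne : a ≠ b) : R.len a < R.len b := by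
  rcases Relation.ReflTransGen.cases_tail h with h | ⟨c, hac, hcb⟩
  · exact absurd h.symm hne
  · have hc : c ∈ R.weylGroup := by
      obtain ⟨l, -, rfl⟩ := hR.exists_reduced hb
      obtain ⟨l', -, -, rfl⟩ := hR.exists_sublist_of_step hcb
      exact wordProd_mem l'
    exact (hR.len_le_of_chainLE hac hc).trans_lt (hR.len_lt_of_step hcb hb)

theorem step_S (hR : R.IsRootSystem) {g : R.Aut} {j : Fin R.r} (h : g⁻¹ (R.α j) ∈ R.pos) :
    R.BruhatStep g (R.S j * g) := ⟨R.α j, hR.simple_pos j, h, rfl⟩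

theorem S_step (hR : R.IsRootSystem) {g : R.Aut} (hg : g ∈ R.weylGroup) {j : Fin R.r}
    (h : g⁻¹ (R.α j) ∉ R.pos) :
    R.BruhatStep (R.S j * g) g := by
  refine ⟨R.α j, hR.simple_pos j, ?_, (hR.S_mul_S_mul j g).symm⟩
  rw [mul_inv_rev, hR.S_inv, LinearEquiv.mul_apply, S, hR.s_self (hR.simple_mem j), map_neg]
  exact hR.neg_mem_pos ((hR.weylGroup_le_rootStab (inv_mem hg) _).2 (hR.simple_mem j)) h

theorem len_lt_len_S_mul_iff (hR : R.IsRootSystem) {g : R.Aut} (hg : g ∈ R.weylGroup)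
    (j : Fin R.r) :
    R.len g < R.len (R.S j * g) ↔ g⁻¹ (R.α j) ∈ R.pos := by
  refine ⟨fun h => ?_, fun h => hR.len_lt_of_step (hR.step_S h) (mul_mem (S_mem j) hg)⟩
  by_contra hn
  exact absurd h (hR.len_lt_of_step (hR.S_step hg hn) hg).not_gt

theorem step_S_mul (hR : R.IsRootSystem) {a b : R.Aut} (h : R.BruhatStep a b) (j : Fin R.r) :
    b = R.S j * a ∨ R.BruhatStep (R.S j * a) (R.S j * b) := by
  obtain ⟨β, hβ, hβ', rfl⟩ := h
  by_cases hj : R.S j β ∈ R.pos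
  · refine Or.inr ⟨R.S j β, hj, ?_, ?_⟩
    · rwa [mul_inv_rev, hR.S_inv, LinearEquiv.mul_apply, ← LinearEquiv.mul_apply (R.S j),
        hR.S_mul_S]
    · rw [← mul_assoc, ← mul_assoc, hR.s_mul_S j (hR.pos_subset hβ)]
  · exact Or.inl (by rw [hR.s_eq_S hβ hj])

theorem chainLE_S_mul_left (hR : R.IsRootSystem) {a b : R.Aut} (h : R.ChainLE a b) (j : Fin R.r) :
    R.ChainLE (R.S j * a) b ∨ R.ChainLE (R.S j * a) (R.S j * b) := by
  induction h using Relation.ReflTransGen.head_induction_on with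
  | refl => exact Or.inr .refl
  | head hs hc ih =>
    rcases hR.step_S_mul hs j with rfl | hs'
    · exact Or.inl hc
    · exact ih.imp (.head hs') (.head hs')

theorem chainLE_S_mul_right (hR : R.IsRootSystem) {a b : R.Aut} (h : R.ChainLE a b) (j : Fin R.r) :
    R.ChainLE a (R.S j * b) ∨ R.ChainLE (R.S j * a) (R.S j * b) := by
  induction h with
  | refl => exact Or.inr .refl
  | tail hc hs ih =>
    rcases hR.step_S_mul hs j with rfl | hs'
    · exact Or.inl (by rwa [hR.S_mul_S_mul])
    · exact ih.imp (fun h => .tail h hs') (fun h => .tail h hs')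

theorem chainLE_dmulStep (hR : R.IsRootSystem) {g : R.Aut} (hg : g ∈ R.weylGroup) (j : Fin R.r) :
    R.ChainLE g (R.dmulStep j g) := by
  unfold dmulStep
  split_ifs with h
  · exact .single (hR.step_S ((hR.len_lt_len_S_mul_iff hg j).1 h))
  · exact .refl

theorem S_mul_chainLE_dmulStep (hR : R.IsRootSystem) {g : R.Aut} (hg : g ∈ R.weylGroup)
    (j : Fin R.r) :
    R.ChainLE (R.S j * g) (R.dmulStep j g) := by
  unfold dmulStep
  split_ifs with h
  · exact .refl
  · exact .single (hR.S_step hg (mt (hR.len_lt_len_S_mul_iff hg j).2 h))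

theorem wordProd_mul_chainLE_dmulList (hR : R.IsRootSystem) {g : R.Aut} (hg : g ∈ R.weylGroup)
    {l' l : List (Fin R.r)} (h : l'.Sublist l) :
    R.ChainLE (R.wordProd l' * g) (R.dmulList l g) := by
  induction h with
  | slnil => rw [wordProd_nil, one_mul]; exact .refl
  | cons j _ ih => exact ih.trans (hR.chainLE_dmulStep (dmulList_mem hg _) j)
  | cons_cons j _ ih =>
    rw [wordProd_cons, mul_assoc]
    have hm := dmulList_mem hg
    rcases hR.chainLE_S_mul_left ih j with h | h
    · exact h.trans (hR.chainLE_dmulStep (hm _) j)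
    · exact h.trans (hR.S_mul_chainLE_dmulStep (hm _) j)

theorem chainLE_of_bruhatLE (hR : R.IsRootSystem) {a b : R.Aut} (h : R.BruhatLE a b) :
    R.ChainLE a b := by
  obtain ⟨l, hl, rfl, l', hs, rfl⟩ := h
  have := hR.wordProd_mul_chainLE_dmulList (one_mem _) hs
  rwa [mul_one, dmulList_one hl] at this

theorem coroot_s (hR : R.IsRootSystem) {β γ : R.V} (hβ : β ∈ R.Φ) (hγ : γ ∈ R.Φ) (z : R.V) :
    R.coroot (R.s γ β) z = R.coroot β (R.s γ z) := by
  rw [← hR.coroot_map (hR.s_mem_rootStab hγ) hβ (R.s γ z), ← LinearEquiv.mul_apply (R.s γ) (R.s γ),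
    hR.s_mul_s hγ, LinearEquiv.coe_one, id]

/-- The invariant form `(a, b) ↦ ∑ ⟨a, β^∨⟩⟨b, β^∨⟩` computes the coroots. -/
theorem coroot_mul_sum (hR : R.IsRootSystem) {γ : R.V} (hγ : γ ∈ R.Φ) (a : R.V) :
    R.coroot γ a * ∑ β ∈ hR.finite.toFinset, R.coroot β γ * R.coroot β γ =
      2 * ∑ β ∈ hR.finite.toFinset, R.coroot β a * R.coroot β γ := by
  have inv : ∑ β ∈ hR.finite.toFinset, R.coroot β (R.s γ a) * R.coroot β (R.s γ γ) =
      ∑ β ∈ hR.finite.toFinset, R.coroot β a * R.coroot β γ := by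
    have hss : ∀ β, R.s γ (R.s γ β) = β := fun β => by
      rw [← LinearEquiv.mul_apply, hR.s_mul_s hγ, LinearEquiv.coe_one, id]
    refine Finset.sum_nbij' (R.s γ) (R.s γ) ?_ ?_ (fun β _ => hss β) (fun β _ => hss β) ?_
    · intro β hβ
      simpa using (hR.s_mem_rootStab hγ β).2 (by simpa using hβ)
    · intro β hβ
      simpa using (hR.s_mem_rootStab hγ β).2 (by simpa using hβ)
    · intro β hβ
      have hβ : β ∈ R.Φ := by simpa using hβ
      rw [hR.coroot_s hβ hγ, hR.coroot_s hβ hγ]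
  rw [hR.s_self hγ, hR.s_apply hγ] at inv
  simp only [map_sub, map_smul, map_neg, smul_eq_mul, sub_mul, mul_neg,
    Finset.sum_neg_distrib, Finset.sum_sub_distrib, mul_assoc] at inv
  rw [Finset.mul_sum]
  linear_combination inv

theorem coroot_nonneg (hR : R.IsRootSystem) {lam : R.V} (hdom : R.Dominant lam) {β : R.V}
    (hβ : β ∈ R.pos) :
    0 ≤ R.coroot β lam := by
  have hpos : ∀ γ ∈ R.Φ, 0 < ∑ β ∈ hR.finite.toFinset, R.coroot β γ * R.coroot β γ :=
    fun γ hγ => Finset.sum_pos' (fun β _ => mul_self_nonneg _)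
      ⟨γ, by simpa using hγ, by rw [hR.coroot_self γ hγ]; norm_num⟩
  have h1 := hR.coroot_mul_sum (hR.pos_subset hβ) lam
  suffices 0 ≤ ∑ γ ∈ hR.finite.toFinset, R.coroot γ lam * R.coroot γ β by
    have h2 := hpos β (hR.pos_subset hβ)
    by_contra! hn
    nlinarith [mul_neg_of_neg_of_pos hn h2]
  have h3 : ∀ γ, R.coroot γ lam * R.coroot γ β =
      ∑ j, hR.coweight j β * (R.coroot γ lam * R.coroot γ (R.α j)) := fun γ => by
    conv_lhs => rw [← hR.sum_coweight β]
    simp only [map_sum, map_smul, smul_eq_mul, Finset.mul_sum]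
    exact Finset.sum_congr rfl fun j _ => by ring
  simp only [h3]
  rw [Finset.sum_comm]
  refine Finset.sum_nonneg fun j _ => ?_
  rw [← Finset.mul_sum]
  refine mul_nonneg (hR.coweight_nonneg hβ j) ?_
  have h4 := hR.coroot_mul_sum (hR.simple_mem j) lam
  nlinarith [mul_nonneg (hdom j) (hpos _ (hR.simple_mem j)).le]

/-- The sum of the positive roots is strictly dominant. -/
theorem exists_strictly_dominant (hR : R.IsRootSystem) : ∃ rho : R.V, ∀ j, 0 < R.coroot
    (R.α j) rho := by
  have hfin : R.pos.Finite := hR.finite.subset hR.pos_subset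
  refine ⟨∑ β ∈ hfin.toFinset, β, fun j => ?_⟩
  rw [map_sum, ← Finset.sum_filter_add_sum_filter_not _ (fun β => R.S j β ∈ R.pos)]
  have h0 : ∑ β ∈ hfin.toFinset with R.S j β ∈ R.pos, R.coroot (R.α j) β = 0 := by
    have hS : ∀ β, R.S j (R.S j β) = β := fun β => by
      rw [← LinearEquiv.mul_apply, hR.S_mul_S, LinearEquiv.coe_one, id]
    have hc : ∀ β, R.coroot (R.α j) (R.S j β) = -R.coroot (R.α j) β := fun β => by
      rw [hR.S_apply, map_sub, map_smul, hR.coroot_self _ (hR.simple_mem j), smul_eq_mul]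
      ring
    refine Finset.sum_involution (fun β _ => R.S j β) (fun β _ => ?_) (fun β _ h1 h2 => h1 ?_)
      (fun β h => ?_) (fun β _ => hS β)
    · rw [hc]; ring
    · have h3 := hc β
      rw [h2] at h3
      linarith
    · simp only [Finset.mem_filter, Set.Finite.mem_toFinset] at h ⊢
      exact ⟨h.2, by rw [hS]; exact h.1⟩
  rw [h0, zero_add]
  refine Finset.sum_pos (fun β h => ?_) ⟨R.α j, ?_⟩
  · simp only [Finset.mem_filter, Set.Finite.mem_toFinset] at h
    obtain ⟨h1, h2⟩ := hR.eq_smul_simple h.1 h.2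
    rw [h2, map_smul, hR.coroot_self _ (hR.simple_mem j), smul_eq_mul]
    linarith
  · simp only [Finset.mem_filter, Set.Finite.mem_toFinset]
    refine ⟨hR.simple_pos j, ?_⟩
    rw [S, hR.s_self (hR.simple_mem j)]
    exact hR.neg_notMem_pos (hR.simple_pos j)

theorem coweight_inv_s_mul (hR : R.IsRootSystem) (i : Fin R.r) {β : R.V} (hβ : β ∈ R.Φ) (a : R.Aut)
    (z : R.V) :
    hR.coweight i ((R.s β * a)⁻¹ z) =
      hR.coweight i (a⁻¹ z) - R.coroot β z * hR.coweight i (a⁻¹ β) := by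
  rw [mul_inv_rev, hR.s_inv hβ, LinearEquiv.mul_apply, hR.s_apply hβ]
  simp

/-- Pairing a dominant weight with the orbit of a fundamental coweight is antitone in the
Bruhat order. -/
theorem coweight_antitone (hR : R.IsRootSystem) {lam : R.V} (hdom : R.Dominant lam) (i : Fin R.r)
    {a b : R.Aut}
    (h : R.ChainLE a b) : hR.coweight i (b⁻¹ lam) ≤ hR.coweight i (a⁻¹ lam) := by
  induction h with
  | refl => exact le_rfl
  | tail _ hs ih =>
    obtain ⟨β, hβ, hβ', rfl⟩ := hs
    rw [hR.coweight_inv_s_mul i (hR.pos_subset hβ)]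
    have := mul_nonneg (hR.coroot_nonneg hdom hβ) (hR.coweight_nonneg hβ' i)
    linarith

theorem coweight_WPar (hR : R.IsRootSystem) {i : Fin R.r} {p : R.Aut} (hp : p ∈ R.WPar i)
    (z : R.V) :
    hR.coweight i (p z) = hR.coweight i z := by
  induction hp using Subgroup.closure_induction generalizing z with
  | mem g hg =>
    obtain ⟨j, hj, rfl⟩ := hg
    exact hR.coweight_S hj z
  | one => rfl
  | mul a b _ _ ha hb => rw [LinearEquiv.mul_apply, ha, hb]
  | inv a _ ha => rw [← ha, Aut.apply_inv_self]

/-- Reduced words of elements fixing a fundamental coweight avoid the corresponding letter. -/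
theorem ne_of_mem_reduced (hR : R.IsRootSystem) {i : Fin R.r} {l : List (Fin R.r)}
    (hl : R.Reduced l)
    (h : ∀ z, hR.coweight i (R.wordProd l z) = hR.coweight i z) : ∀ j ∈ l, j ≠ i := by
  induction l with
  | nil => simp
  | cons j l ih =>
    have hj : j ≠ i := by
      rintro rfl
      have hm := wordProd_mem (j :: l)
      have hp : (R.wordProd (j :: l))⁻¹ (R.α j) ∈ R.pos := by
        refine hR.mem_pos_of_coweight_pos (j := j)
          ((hR.weylGroup_le_rootStab (inv_mem hm) _).2 (hR.simple_mem j)) ?_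
        rw [← h, Aut.apply_inv_self, hR.coweight_simple, if_pos rfl]
        exact one_pos
      have h1 := (hR.len_lt_len_S_mul_iff hm j).2 hp
      have h2 := len_wordProd_le l
      rw [hl, wordProd_cons, hR.S_mul_S_mul, List.length_cons] at h1
      omega
    rw [List.forall_mem_cons]
    refine ⟨hj, ih (Reduced.tail hl) fun z => ?_⟩
    rw [← h z, wordProd_cons, LinearEquiv.mul_apply, hR.coweight_S hj]

theorem mem_WPar (hR : R.IsRootSystem) {i : Fin R.r} {p : R.Aut} (hp : p ∈ R.weylGroup)
    (h : ∀ z, hR.coweight i (p z) = hR.coweight i z) : p ∈ R.WPar i := by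
  obtain ⟨l, hl, rfl⟩ := hR.exists_reduced hp
  exact wordProd_mem_WPar (hR.ne_of_mem_reduced hl h)

theorem minRep_apply_mem_pos (hR : R.IsRootSystem) {i : Fin R.r} {u : R.Aut} (hu : u ∈ R.minReps i)
    {δ : R.V}
    (hδ : δ ∈ R.pos) (h0 : hR.coweight i δ = 0) : u δ ∈ R.pos := by
  obtain ⟨huW, hmin⟩ := hu
  have hs : ∀ j, j ≠ i → u (R.α j) ∈ R.pos := fun j hj => by
    by_contra hn
    have h1 := hR.len_lt_of_step (hR.S_step (inv_mem huW) (j := j) (by rwa [inv_inv]))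
      (inv_mem huW)
    have h2 := hmin (R.S j) (Subgroup.subset_closure ⟨j, hj, rfl⟩)
    rw [hR.len_inv huW, ← hR.len_inv (mul_mem (S_mem j) (inv_mem huW)), mul_inv_rev, inv_inv,
      hR.S_inv] at h1
    omega
  refine hR.mem_pos_of_coweight_nonneg
    ((hR.weylGroup_le_rootStab huW _).2 (hR.pos_subset hδ)) fun k => ?_
  rw [← hR.sum_coweight δ, map_sum, map_sum]
  refine Finset.sum_nonneg fun j _ => ?_
  rw [map_smul, map_smul, smul_eq_mul]
  by_cases hj : j = i
  · rw [hj, h0, zero_mul]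
  · exact mul_nonneg (hR.coweight_nonneg hδ j) (hR.coweight_nonneg (hs j hj) k)

theorem mem_of_chainLE (hR : R.IsRootSystem) {a b : R.Aut} (h : R.ChainLE a b)
    (hb : b ∈ R.weylGroup) :
    a ∈ R.weylGroup := by
  obtain ⟨l, -, rfl⟩ := hR.exists_reduced hb
  obtain ⟨l', -, rfl⟩ := hR.exists_sublist_of_chainLE h rfl
  exact wordProd_mem l'

/-- Elements below a Demazure product `l * v` in the same coset of `W_{P_i}` are of the form
`a v` with `a` a subword of `l`. -/
theorem exists_sublist_of_chainLE_dmulList (hR : R.IsRootSystem) {i : Fin R.r} {v : R.Aut}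
    (hv : v ∈ R.minReps i)
    (l : List (Fin R.r)) {m : R.Aut} (h : R.ChainLE m (R.dmulList l v))
    (hm : ∀ z, hR.coweight i (m⁻¹ z) = hR.coweight i ((R.dmulList l v)⁻¹ z)) :
    ∃ l' : List (Fin R.r), l'.Sublist l ∧ m = R.wordProd l' * v := by
  induction l generalizing m with
  | nil =>
    refine ⟨[], List.Sublist.refl _, ?_⟩
    rw [wordProd_nil, one_mul]
    by_contra hne
    have hmW := hR.mem_of_chainLE h hv.1
    have hp : v⁻¹ * m ∈ R.WPar i := hR.mem_WPar (mul_mem (inv_mem hv.1) hmW) fun z => by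
      have := hm (m z)
      rw [Aut.inv_apply_self] at this
      exact this.symm
    have h1 := hv.2 _ hp
    rw [mul_inv_cancel_left] at h1
    exact absurd (hR.len_lt_of_chainLE h hv.1 hne) h1.not_gt
  | cons j l ih =>
    set M := R.dmulList l v
    have hMW : M ∈ R.weylGroup := dmulList_mem hv.1 l
    change R.ChainLE m (R.dmulStep j M) at h
    change ∀ z, hR.coweight i (m⁻¹ z) = hR.coweight i ((R.dmulStep j M)⁻¹ z) at hm
    have skip : R.ChainLE m M → (∀ z, hR.coweight i (m⁻¹ z) = hR.coweight i (M⁻¹ z)) →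
        ∃ l' : List (Fin R.r), l'.Sublist (j :: l) ∧ m = R.wordProd l' * v := fun h1 h2 => by
      obtain ⟨l', h3, h4⟩ := ih h1 h2
      exact ⟨l', h3.cons j, h4⟩
    have take : R.ChainLE (R.S j * m) M →
        (∀ z, hR.coweight i ((R.S j * m)⁻¹ z) = hR.coweight i (M⁻¹ z)) →
        ∃ l' : List (Fin R.r), l'.Sublist (j :: l) ∧ m = R.wordProd l' * v := fun h1 h2 => by
      obtain ⟨l', h3, h4⟩ := ih h1 h2
      exact ⟨j :: l', h3.cons_cons j, by
        rw [wordProd_cons, mul_assoc, ← h4, hR.S_mul_S_mul]⟩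
    unfold dmulStep at h hm
    split_ifs at h hm with hlt
    · have hpos := (hR.len_lt_len_S_mul_iff hMW j).1 hlt
      have hSm : ∀ z, hR.coweight i ((R.S j * m)⁻¹ z) = hR.coweight i (M⁻¹ z) := fun z => by
        rw [mul_inv_rev, hR.S_inv, LinearEquiv.mul_apply, hm, mul_inv_rev, hR.S_inv,
          LinearEquiv.mul_apply, ← LinearEquiv.mul_apply (R.S j), hR.S_mul_S,
          LinearEquiv.coe_one, id]
      rcases hR.chainLE_S_mul_right h j with h' | h' <;> rw [hR.S_mul_S_mul] at h'
      · have hform := fun z => hR.coweight_inv_s_mul i (hR.simple_mem j) M z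
        rcases (hR.coweight_nonneg hpos i).eq_or_lt with h0 | h0
        · refine skip h' fun z => ?_
          rw [hm, S, hform, ← h0, mul_zero, sub_zero]
        · obtain ⟨rho, hrho⟩ := hR.exists_strictly_dominant
          have h1 := hR.coweight_antitone (fun k => (hrho k).le) i h'
          rw [hm, S, hform] at h1
          linarith [mul_pos (hrho j) h0]
      · exact take h' hSm
    · exact skip h hm

/-- Elements below `u y⁻¹` minimizing the pairing move a dominant weight into the Demazure set of
`y`. -/
theorem exists_bruhatLE_of_chainLE (hR : R.IsRootSystem) {lam : R.V} (hdom : R.Dominant lam)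
    {i : Fin R.r}
    {u y : R.Aut} (hu : u ∈ R.minReps i) (hy : y ∈ R.WPar i) {m : R.Aut}
    (h : R.ChainLE m (u * y⁻¹)) (hm : hR.coweight i (m⁻¹ lam) = hR.coweight i (u⁻¹ lam)) :
    ∃ y', R.BruhatLE y' y ∧ m⁻¹ lam = y' (u⁻¹ lam) := by
  have hyW := WPar_le_weylGroup i hy
  have hM : u * y⁻¹ ∈ R.weylGroup := mul_mem hu.1 (inv_mem hyW)
  have hMlam : (u * y⁻¹)⁻¹ lam = y (u⁻¹ lam) := by rw [mul_inv_rev, inv_inv]; rfl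
  induction h using Relation.ReflTransGen.head_induction_on with
  | refl =>
    obtain ⟨l, hl, rfl⟩ := hR.exists_reduced hyW
    exact ⟨R.wordProd l, ⟨l, hl, rfl, l, List.Sublist.refl l, rfl⟩, hMlam⟩
  | @head a c hs hc ih =>
    have haW := hR.mem_of_chainLE (.head hs hc) hM
    obtain ⟨β, hβ, hβ', rfl⟩ := hs
    have hΦ := hR.pos_subset hβ
    have hΦ' := hR.pos_subset hβ'
    have hform := hR.coweight_inv_s_mul i hΦ a lam
    have h1 := hR.coweight_antitone hdom i hc
    rw [hMlam, hR.coweight_WPar hy] at h1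
    have hn1 := hR.coroot_nonneg hdom hβ
    have hn2 := hR.coweight_nonneg hβ' i
    have h2 := mul_nonneg hn1 hn2
    obtain ⟨y', hle, hy'⟩ := ih (by linarith)
    rcases hn1.eq_or_lt with h0 | h0
    · refine ⟨y', hle, ?_⟩
      rw [← hy', mul_inv_rev, hR.s_inv hΦ, LinearEquiv.mul_apply, hR.s_apply hΦ, ← h0, zero_smul,
        sub_zero]
    have hx0 : hR.coweight i (a⁻¹ β) = 0 := by
      have h3 : R.coroot β lam * hR.coweight i (a⁻¹ β) = 0 := by linarith
      exact (mul_eq_zero.1 h3).resolve_left h0.ne'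
    obtain ⟨l, hl, rfl, l', hsub, rfl⟩ := hle
    have hPar : R.wordProd l' ∈ R.WPar i := wordProd_mem_WPar fun j hj =>
      hR.ne_of_mem_reduced hl (hR.coweight_WPar hy) j (hsub.subset hj)
    have haS := hR.weylGroup_le_rootStab (inv_mem haW)
    have hcomm : (R.s β * a)⁻¹ = R.s (a⁻¹ β) * a⁻¹ := by
      rw [mul_inv_rev, hR.s_inv hΦ, hR.s_map haS hΦ]
    have hneg : (R.wordProd l')⁻¹ (a⁻¹ β) ∉ R.pos := fun hp => by
      have h4 := hR.minRep_apply_mem_pos hu hp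
        (by rw [hR.coweight_WPar (inv_mem hPar), hx0])
      have h5 := hR.coroot_nonneg hdom h4
      rw [← Aut.apply_inv_self u lam,
        hR.coroot_map (hR.weylGroup_le_rootStab hu.1) (hR.pos_subset hp),
        ← Aut.inv_apply_self (R.wordProd l') (u⁻¹ lam), ← hy',
        hR.coroot_map (hR.weylGroup_le_rootStab (inv_mem (wordProd_mem l'))) hΦ',
        mul_inv_rev, hR.s_inv hΦ, LinearEquiv.mul_apply, hR.coroot_map haS hΦ, hR.s_apply hΦ,
        map_sub, map_smul, hR.coroot_self β hΦ, smul_eq_mul] at h5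
      linarith
    obtain ⟨l'', hs'', -, h6⟩ := hR.exchange l' hβ' hneg
    refine ⟨R.wordProd l'', ⟨l, hl, rfl, l'', hs''.trans hsub, rfl⟩, ?_⟩
    rw [← h6, LinearEquiv.mul_apply, ← hy', hcomm, ← LinearEquiv.mul_apply, ← mul_assoc,
      hR.s_mul_s hΦ', one_mul]

theorem eq_coweight (hR : R.IsRootSystem) {x : Fin R.r → Module.Dual ℚ R.V}
    (hx : ∀ i j : Fin R.r, x j (R.α i) = if i = j then 1 else 0) (i : Fin R.r) :
    x i = hR.coweight i :=
  hR.basis.ext fun j => by rw [hR.basis_apply, hx, hR.coweight_simple]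

end IsRootSystem

end RootData

/-- The part of a convex hull on which a linear functional attains its lower bound is the convex
hull of the generators attaining it. -/
theorem mem_convexHull_face {V : Type*} [AddCommGroup V] [Module ℚ V] {T : Set V}
    {f : Module.Dual ℚ V} {c : ℚ} (hT : ∀ t ∈ T, c ≤ f t) {m : V} (hm : m ∈ convexHull ℚ T)
    (hfm : f m = c) : m ∈ convexHull ℚ {t | t ∈ T ∧ f t = c} := by
  have hconv : Convex ℚ {z | c ≤ f z ∧ (f z = c → z ∈ convexHull ℚ {t | t ∈ T ∧ f t = c})} := by
    rw [convex_iff_forall_pos]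
    rintro z ⟨hz, hz'⟩ z' ⟨hw, hw'⟩ a b ha hb hab
    have e : f (a • z + b • z') = c + (a * (f z - c) + b * (f z' - c)) := by
      simp only [map_add, map_smul, smul_eq_mul]
      linear_combination c * hab
    have h1 := mul_nonneg ha.le (sub_nonneg.2 hz)
    have h2 := mul_nonneg hb.le (sub_nonneg.2 hw)
    refine ⟨by linarith, fun h => ?_⟩
    have h3 : a * (f z - c) = 0 := by linarith
    have h4 : b * (f z' - c) = 0 := by linarith
    exact convex_convexHull ℚ _
      (hz' (sub_eq_zero.1 ((mul_eq_zero.1 h3).resolve_left ha.ne')))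
      (hw' (sub_eq_zero.1 ((mul_eq_zero.1 h4).resolve_left hb.ne'))) ha.le hb.le hab
  refine (convexHull_min (fun t ht => ?_) hconv hm).2 hfm
  exact ⟨hT t ht, fun h => subset_convexHull ℚ _ ⟨ht, h⟩⟩

theorem statement17 (R : RootData) (hR : R.IsRootSystem)
    (x : Fin R.r → Module.Dual ℚ R.V)
    (hx : ∀ i j : Fin R.r, x j (R.α i) = if i = j then 1 else 0)
    (lam : R.V) (hdom : R.Dominant lam)
    (w : R.Aut) (hw : w ∈ R.weylGroup)
    (hmax : ∀ σ : R.Aut, σ ∈ R.weylGroup → σ lam = lam → R.len (w * σ) ≤ R.len w)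
    (i : Fin R.r) (v : R.Aut) (hv : v ∈ R.minReps i)
    (u : R.Aut) (hu : R.IsMinRep i u (R.dmul w⁻¹ v))
    (y : R.Aut) (hy : y ∈ R.WPar i) (hy1 : R.dmul w⁻¹ v = u * y⁻¹)
    (hy2 : R.len (u * y⁻¹) = R.len u + R.len y) :
    (fun m : R.V => v⁻¹ m) ''
        {m | m ∈ R.demPolytope lam w ∧
          R.dualAct v (x i) m = R.dualAct u (x i) lam} =
      convexHull ℚ {m : R.V | ∃ y' : R.Aut, R.BruhatLE y' y ∧ m = y' (u⁻¹ lam)} := by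
  have hex := hR.exists_reduced (inv_mem hw)
  obtain ⟨l, hl, hlw, hdm⟩ : ∃ l, R.Reduced l ∧ R.wordProd l = w⁻¹ ∧
      R.dmulList l v = u * y⁻¹ :=
    ⟨hex.choose, hex.choose_spec.1, hex.choose_spec.2, by
      rw [← hy1, RootData.dmul, dif_pos hex]⟩
  have hrev : R.wordProd l.reverse = w := by rw [hR.wordProd_reverse, hlw, inv_inv]
  have hyW := RootData.WPar_le_weylGroup i hy
  have hM : ∀ z, hR.coweight i ((u * y⁻¹)⁻¹ z) = hR.coweight i (u⁻¹ z) := fun z => by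
    rw [mul_inv_rev, inv_inv, LinearEquiv.mul_apply, hR.coweight_WPar hy]
  have hact : ∀ g z, R.dualAct g (x i) z = hR.coweight i (g⁻¹ z) := fun g z => by
    rw [hR.eq_coweight hx]; rfl
  have hle : ∀ g, R.BruhatLE g w → R.ChainLE (g⁻¹ * v) (u * y⁻¹) := fun g hg => by
    obtain ⟨l', h1, rfl⟩ := hR.exists_sublist_of_chainLE (hR.chainLE_of_bruhatLE hg) hrev
    rw [← hdm, ← hR.wordProd_reverse]
    exact hR.wordProd_mul_chainLE_dmulList hv.1 (by simpa using h1.reverse)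
  have hinv : ∀ g : R.Aut, (g⁻¹ * v)⁻¹ lam = v⁻¹ (g lam) := fun g => by
    rw [mul_inv_rev, inv_inv]; rfl
  refine Set.Subset.antisymm ?_ ?_
  · rintro _ ⟨m, ⟨hm, hfm⟩, rfl⟩
    have hface := mem_convexHull_face (fun t ht => ?_) hm hfm
    · have himg := Set.mem_image_of_mem (v⁻¹ : R.Aut).toLinearMap hface
      rw [LinearMap.image_convexHull] at himg
      refine convexHull_mono ?_ himg
      rintro _ ⟨_, ⟨⟨g, -, hg, rfl⟩, hgf⟩, rfl⟩
      rw [hact, hact, ← hinv] at hgf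
      obtain ⟨y', h1, h2⟩ := hR.exists_bruhatLE_of_chainLE hdom hu.1 hy (hle g hg) hgf
      exact ⟨y', h1, by rw [← h2, hinv]; rfl⟩
    · obtain ⟨g, -, hg, rfl⟩ := ht
      rw [hact, hact, ← hinv, ← hM]
      exact hR.coweight_antitone hdom i (hle g hg)
  · have himage : (fun m : R.V => v⁻¹ m) '' {m | m ∈ R.demPolytope lam w ∧
        R.dualAct v (x i) m = R.dualAct u (x i) lam} =
        (v⁻¹ : R.Aut).toLinearMap '' (convexHull ℚ {m | ∃ g : R.Aut, g ∈ R.weylGroup ∧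
          R.BruhatLE g w ∧ m = g lam} ∩
          (R.dualAct v (x i)) ⁻¹' {R.dualAct u (x i) lam}) := rfl
    rw [himage]
    refine convexHull_min ?_ (((convex_convexHull ℚ _).inter
      ((convex_singleton _).linear_preimage _)).linear_image _)
    rintro _ ⟨y', ⟨ly, hly, rfl, l', hsub, rfl⟩, rfl⟩
    have hPar : R.wordProd l' ∈ R.WPar i := RootData.wordProd_mem_WPar fun j hj =>
      hR.ne_of_mem_reduced hly (hR.coweight_WPar hy) j (hsub.subset hj)
    obtain ⟨lu, hlu, rfl⟩ := hR.exists_reduced hu.1.1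
    have hB : R.BruhatLE (R.wordProd lu * (R.wordProd l')⁻¹)
        (R.wordProd lu * (R.wordProd ly)⁻¹) := by
      refine ⟨lu ++ ly.reverse, ?_, ?_, lu ++ l'.reverse,
        (List.Sublist.refl lu).append hsub.reverse, ?_⟩
      · rw [RootData.Reduced, RootData.wordProd_append, hR.wordProd_reverse, hy2, hlu, hly,
          List.length_append, List.length_reverse]
      · rw [RootData.wordProd_append, hR.wordProd_reverse]
      · rw [RootData.wordProd_append, hR.wordProd_reverse]
    have hC := hR.chainLE_of_bruhatLE hB
    rw [← hdm] at hC
    obtain ⟨la, hla, hm⟩ := hR.exists_sublist_of_chainLE_dmulList hv l hC fun z => by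
      rw [hdm, hM, mul_inv_rev, inv_inv, LinearEquiv.mul_apply, hR.coweight_WPar hPar]
    have hval : v⁻¹ ((R.wordProd la)⁻¹ lam) = R.wordProd l' ((R.wordProd lu)⁻¹ lam) := by
      have h1 := congrArg (fun g : R.Aut => g⁻¹ lam) hm
      simp only [mul_inv_rev, inv_inv, LinearEquiv.mul_apply] at h1
      exact h1.symm
    refine ⟨(R.wordProd la)⁻¹ lam, ⟨subset_convexHull ℚ _ ⟨(R.wordProd la)⁻¹,
      inv_mem (RootData.wordProd_mem la), ⟨l.reverse, hR.reduced_reverse hl, hrev, la.reverse,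
      hla.reverse, hR.wordProd_reverse la⟩, rfl⟩, ?_⟩, hval⟩
    rw [Set.mem_preimage, Set.mem_singleton_iff, hact, hact, hval, hR.coweight_WPar hPar]
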